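/- arXiv:1611.08236 — 3 statements merged into one kernel-verified Lean document; each statement's English description precedes it below -/
import Mathlib

section
/- Let q : ℝ^m → ℝ^l be twice continuously differentiable, Γ := {y ∈ ℝ^m : q_i(y) ≤ 0, i = 1,…,l}, ȳ ∈ Γ, v ∈ T^lin(ȳ), and let Ĵ ∈ J̄(v) be a maximal index set such that (q_i)_{i∈Ĵ} is 2-regular at ȳ in direction v. Then for every subset J ⊂ Ĵ there exist τ̄ > 0 and a mapping ŷ : [0,τ̄] → Γ such that ŷ(0) = ȳ, I(ŷ(τ)) = J and LICQ is fulfilled at ŷ(τ) for every τ ∈ (0,τ̄), and lim_{τ↓0} (ŷ(τ) − ȳ)/τ = v. -/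
open Set Filter Topology Metric RealInnerProductSpace

noncomputable section

/-- Euclidean space `ℝ^d`. -/
abbrev Em (d : ℕ) : Type := EuclideanSpace ℝ (Fin d)

section General

variable {H : Type*} [NormedAddCommGroup H] [NormedSpace ℝ H]

/-- Bouligand tangent (contingent) cone to `Ω` at `z`. -/
def tanCone (Ω : Set H) (z : H) : Set H :=
  {u | ∃ (t : ℕ → ℝ) (uk : ℕ → H), (∀ k, 0 < t k) ∧ Tendsto t atTop (𝓝 0) ∧
    Tendsto uk atTop (𝓝 u) ∧ ∀ k, z + t k • uk k ∈ Ω}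

open Classical in
/-- The set `V_{ε,δ}(v)`. -/
def Vset (eps delta : ℝ) (v : H) : Set H :=
  if v = 0 then Metric.closedBall 0 eps
  else {0} ∪ {u | u ∈ Metric.closedBall (0:H) eps ∧ u ≠ 0 ∧
    ‖‖u‖⁻¹ • u - ‖v‖⁻¹ • v‖ ≤ delta}

end General

section InnerSp

variable {H : Type*} [NormedAddCommGroup H] [InnerProductSpace ℝ H]

/-- Negative polar cone. -/
def polarCone (K : Set H) : Set H := {x | ∀ y ∈ K, ⟪x, y⟫ ≤ 0}

/-- Regular (Fréchet) normal cone. -/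
def regNormalCone (Ω : Set H) (z : H) : Set H := polarCone (tanCone Ω z)

/-- Limiting (Mordukhovich) normal cone. -/
def limNormalCone (Ω : Set H) (z : H) : Set H :=
  {x | ∃ (zk xk : ℕ → H), (∀ k, zk k ∈ Ω) ∧ (∀ k, xk k ∈ regNormalCone Ω (zk k)) ∧
    Tendsto zk atTop (𝓝 z) ∧ Tendsto xk atTop (𝓝 x)}

end InnerSp

section ProdSp

variable {E F : Type*} [NormedAddCommGroup E] [InnerProductSpace ℝ E]
  [NormedAddCommGroup F] [InnerProductSpace ℝ F]

/-- Negative polar w.r.t. the natural pairing on a product of inner product spaces. -/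
def polarConeP (K : Set (E × F)) : Set (E × F) :=
  {p | ∀ q ∈ K, ⟪p.1, q.1⟫ + ⟪p.2, q.2⟫ ≤ 0}

/-- Regular normal cone in a product space. -/
def regNormalConeP (Ω : Set (E × F)) (z : E × F) : Set (E × F) :=
  polarConeP (tanCone Ω z)

/-- Limiting normal cone in a product space. -/
def limNormalConeP (Ω : Set (E × F)) (z : E × F) : Set (E × F) :=
  {x | ∃ (zk xk : ℕ → E × F), (∀ k, zk k ∈ Ω) ∧
    (∀ k, xk k ∈ regNormalConeP Ω (zk k)) ∧
    Tendsto zk atTop (𝓝 z) ∧ Tendsto xk atTop (𝓝 x)}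

/-- Directional limiting normal cone in a product space. -/
def dirLimNormalConeP (Ω : Set (E × F)) (z u : E × F) : Set (E × F) :=
  {x | ∃ (t : ℕ → ℝ) (uk xk : ℕ → E × F), (∀ k, 0 < t k) ∧ Tendsto t atTop (𝓝 0) ∧
    Tendsto uk atTop (𝓝 u) ∧ Tendsto xk atTop (𝓝 x) ∧
    ∀ k, xk k ∈ regNormalConeP Ω (z + t k • uk k)}

end ProdSp

section Metr

variable {X Y : Type*} [PseudoMetricSpace X] [PseudoMetricSpace Y]

/-- `Ψ` is metrically regular near `(ub, vb)` with modulus `κ`. -/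
def MetricallyRegularNear (Ψ : X → Set Y) (ub : X) (vb : Y) (κ : ℝ) : Prop :=
  ∃ U ∈ 𝓝 ub, ∃ V ∈ 𝓝 vb, ∀ u ∈ U, ∀ v ∈ V,
    EMetric.infEdist u {x | v ∈ Ψ x} ≤ ENNReal.ofReal κ * EMetric.infEdist v (Ψ u)

/-- `Ψ` is metrically subregular at `(ub, vb)`. -/
def MetricallySubregularAt (Ψ : X → Set Y) (ub : X) (vb : Y) : Prop :=
  ∃ κ > (0:ℝ), ∃ U ∈ 𝓝 ub, ∀ u ∈ U,
    EMetric.infEdist u {x | vb ∈ Ψ x} ≤ ENNReal.ofReal κ * EMetric.infEdist vb (Ψ u)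

end Metr

section TwoDiff

variable {m p : ℕ}

/-- `g` is twice Fréchet differentiable at `ȳ`. -/
def TwiceDiffAt (g : Em m → Em p) (yb : Em m) : Prop :=
  (∀ᶠ y in 𝓝 yb, DifferentiableAt ℝ g y) ∧ DifferentiableAt ℝ (fderiv ℝ g) yb

/-- Adjoint (transpose) of a continuous linear map between Euclidean spaces. -/
def adjA (A : Em m →L[ℝ] Em p) : Em p →L[ℝ] Em m := ContinuousLinearMap.adjoint A

end TwoDiff

section Q

variable {m l : ℕ}

/-- The feasible set `Γ = {y : q i y ≤ 0 ∀ i}`. -/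
def Gam (q : Em m → Em l) : Set (Em m) := {y | ∀ i, q y i ≤ 0}

/-- `∇q_i(y)v`. -/
def gradQ (q : Em m → Em l) (y : Em m) (i : Fin l) (v : Em m) : ℝ := fderiv ℝ q y v i

/-- `vᵀ∇²q_i(y)w`. -/
def hessQ (q : Em m → Em l) (y : Em m) (i : Fin l) (v w : Em m) : ℝ :=
  fderiv ℝ (fderiv ℝ q) y v w i

/-- `∇q(y)ᵀλ`. -/
def gradT (q : Em m → Em l) (y : Em m) (lam : Em l) : Em m :=
  ContinuousLinearMap.adjoint (fderiv ℝ q y) lam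

/-- `∇²(λᵀq)(y)v = (vᵀ∇²q(y))ᵀλ`. -/
def hessT (q : Em m → Em l) (y : Em m) (lam : Em l) (v : Em m) : Em m :=
  ContinuousLinearMap.adjoint (fderiv ℝ (fderiv ℝ q) y v) lam

/-- The perturbation mapping `M_q(y) = q(y) - ℝ^l_-`. -/
def Mq (q : Em m → Em l) (y : Em m) : Set (Em l) := {z | ∀ i, q y i ≤ z i}

/-- `M_q` is metrically regular in the vicinity of `ȳ`. -/
def MetricallyRegularInVicinity (q : Em m → Em l) (yb : Em m) : Prop :=
  ∃ V ∈ 𝓝 yb, ∃ κ > (0:ℝ), ∀ y ∈ V, y ≠ yb → (0:Em l) ∈ Mq q y →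
    MetricallyRegularNear (Mq q) y (0:Em l) κ

/-- Active index set `I(y)`. -/
def actI (q : Em m → Em l) (y : Em m) : Set (Fin l) := {i | q y i = 0}

/-- `Ī(v) = {i ∈ I(ȳ) : ∇q_i(ȳ)v = 0}`. -/
def IbarDir (q : Em m → Em l) (yb v : Em m) : Set (Fin l) :=
  {i | q yb i = 0 ∧ gradQ q yb i v = 0}

/-- Linearized cone `T^lin(ȳ)`. -/
def Tlin (q : Em m → Em l) (yb : Em m) : Set (Em m) :=
  {v | ∀ i ∈ actI q yb, gradQ q yb i v ≤ 0}

/-- The normal cone `N_{ℝ^l_-}(q(y))`. -/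
def NRl (q : Em m → Em l) (y : Em m) : Set (Em l) :=
  {mu | (∀ i, 0 ≤ mu i) ∧ ∀ i, q y i ≠ 0 → mu i = 0}

/-- Lagrange multiplier set `Λ(y, y*)`. -/
def Lam (q : Em m → Em l) (y ystar : Em m) : Set (Em l) :=
  {lam | lam ∈ NRl q y ∧ gradT q y lam = ystar}

/-- Directional multiplier set `Λ(y, y*; v)`. -/
def LamDir (q : Em m → Em l) (yb ystar v : Em m) : Set (Em l) :=
  {lam | lam ∈ Lam q yb ystar ∧ ∀ lam' ∈ Lam q yb ystar,
    ∑ i, lam' i * hessQ q yb i v v ≤ ∑ i, lam i * hessQ q yb i v v}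

/-- The set `M̄(v, v*)`. -/
def Mbar (q : Em m → Em l) (yb ystar v vstar : Em m) : Set (Em l × Em l) :=
  {p | p.1 ∈ LamDir q yb ystar v ∧ p.2 ∈ tanCone (NRl q yb) p.1 ∧
    vstar = hessT q yb p.1 v + gradT q yb p.2}

/-- `I⁺(λ)`. -/
def Iplus (lam : Em l) : Set (Fin l) := {i | 0 < lam i}

/-- `I⁺(λ, μ)`. -/
def IplusLM (lam mu : Em l) : Set (Fin l) := {i | 0 < lam i} ∪ {i | lam i = 0 ∧ 0 < mu i}

/-- `P_{I⁺,I}`. -/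
def Pset (Ip I : Set (Fin l)) : Set (Em l) :=
  {mu | (∀ i ∉ I, mu i = 0) ∧ ∀ i ∈ I \ Ip, 0 ≤ mu i}

/-- `K̄_{I⁺,I}`. -/
def Kcone (q : Em m → Em l) (yb : Em m) (Ip I : Set (Fin l)) : Set (Em m) :=
  {w | (∀ i ∈ Ip, gradQ q yb i w = 0) ∧ ∀ i ∈ I \ Ip, gradQ q yb i w ≤ 0}

/-- `K̄_{I⁺,I}(v)`. -/
def KconeDir (q : Em m → Em l) (yb : Em m) (Ip I : Set (Fin l)) (v : Em m) : Set (Em m) :=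
  {w | w ∈ Kcone q yb Ip I ∧ ∃ z : Em m,
    (∀ i ∈ Ip, gradQ q yb i z + hessQ q yb i v w = 0) ∧
    ∀ i ∈ I \ Ip, gradQ q yb i z + hessQ q yb i v w ≤ 0}

/-- `Q(v, λ, I⁺, I)`. -/
def Qset (q : Em m → Em l) (yb v : Em m) (lam : Em l) (Ip I : Set (Fin l)) :
    Set (Em m × Em m) :=
  {p | p.2 ∈ KconeDir q yb Ip I v ∧
    p.1 + hessT q yb lam p.2 ∈ polarCone (KconeDir q yb Ip I v)}

/-- `Q₀(v, λ, I⁺, I)`. -/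
def Qzero (q : Em m → Em l) (yb v : Em m) (lam : Em l) (Ip I : Set (Fin l)) :
    Set (Em m × Em m) :=
  {p | p.2 ∈ KconeDir q yb Ip I v ∧
    ∃ mu ∈ Pset Ip I, p.1 + hessT q yb lam p.2 = gradT q yb mu}

/-- `Ξ̄(v)`, the feasible set of the dual program. -/
def Xibar (q : Em m → Em l) (yb v : Em m) : Set (Em m) :=
  {z | ∀ i ∈ actI q yb, gradQ q yb i z + hessQ q yb i v v ≤ 0}

/-- `J(z)`. -/
def Jset (q : Em m → Em l) (yb v z : Em m) : Set (Fin l) :=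
  {i | i ∈ IbarDir q yb v ∧ gradQ q yb i z + hessQ q yb i v v = 0}

/-- `J̄(v)`. -/
def Jbar (q : Em m → Em l) (yb v : Em m) : Set (Set (Fin l)) :=
  {J | ∃ z ∈ Xibar q yb v, J = Jset q yb v z}

/-- `J` is a maximal element of `J̄(v)`. -/
def MaximalJ (q : Em m → Em l) (yb v : Em m) (J : Set (Fin l)) : Prop :=
  J ∈ Jbar q yb v ∧ ∀ J' ∈ Jbar q yb v, J ⊆ J' → J = J'

/-- `(q_i)_{i ∈ J}` is 2-regular at `ȳ` in direction `v`. -/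
def TwoRegular (q : Em m → Em l) (yb v : Em m) (J : Set (Fin l)) : Prop :=
  ∀ α : Fin l → ℝ, ∃ u w : Em m,
    (∀ i ∈ J, gradQ q yb i u + hessQ q yb i v w = α i) ∧ ∀ i ∈ J, gradQ q yb i w = 0

/-- 2-LICQ holds at `ȳ` in direction `v`. -/
def TwoLICQ (q : Em m → Em l) (yb v : Em m) : Prop :=
  ∃ eps > (0:ℝ), ∃ delta > (0:ℝ), ∀ y : Em m, y - yb ∈ Vset eps delta v →
    y ∈ Gam q → y ≠ yb → TwoRegular q yb v (actI q y)

/-- Gradient vector of `q_i` at `y`. -/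
def gradF (q : Em m → Em l) (y : Em m) (i : Fin l) : Em m := gradient (fun x => q x i) y

/-- LICQ holds at `y`. -/
def LICQat (q : Em m → Em l) (y : Em m) : Prop :=
  LinearIndependent ℝ (fun i : actI q y => gradF q y (i : Fin l))

/-- Graph of the regular normal cone mapping `N̂_Γ`. -/
def GphNhat (q : Em m → Em l) : Set (Em m × Em m) :=
  {p | p.1 ∈ Gam q ∧ p.2 ∈ regNormalCone (Gam q) p.1}

/-- Critical cone `K̄ = T_Γ(ȳ) ∩ (ȳ*)^⊥`. -/
def Kbar (q : Em m → Em l) (yb ystar : Em m) : Set (Em m) :=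
  {v | v ∈ tanCone (Gam q) yb ∧ ⟪ystar, v⟫ = 0}

/-- The null space `N(ȳ)` of the active gradients. -/
def Nspace (q : Em m → Em l) (yb : Em m) : Set (Em m) :=
  {v | ∀ i ∈ actI q yb, gradQ q yb i v = 0}

/-- The union `⋃_{(λ,μ),J} ⋃_{I⁺,I} Q(v,λ,I⁺,I)`. -/
def unionQ (q : Em m → Em l) (yb ystar v vstar : Em m) : Set (Em m × Em m) :=
  {p | ∃ lam mu : Em l, (lam, mu) ∈ Mbar q yb ystar v vstar ∧
    ∃ J ∈ Jbar q yb v, ∃ Ip I : Set (Fin l),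
      IplusLM lam mu ⊆ Ip ∧ Ip ⊆ I ∧ I ⊆ J ∧ p ∈ Qset q yb v lam Ip I}

/-- The cone `N¹_{gph N̂_Γ}((ȳ,ȳ*);(0,v*))`. -/
def N1cone (q : Em m → Em l) (yb ystar vstar : Em m) : Set (Em m × Em m) :=
  {p | ∃ (t : ℕ → ℝ) (vk vks wks wk : ℕ → Em m),
    (∀ k, 0 < t k) ∧ Tendsto t atTop (𝓝 0) ∧ (∀ k, vk k ≠ 0) ∧
    Tendsto vk atTop (𝓝 0) ∧ Tendsto vks atTop (𝓝 vstar) ∧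
    Tendsto (fun k => (wks k, wk k)) atTop (𝓝 p) ∧
    ∀ k, (wks k, wk k) ∈ regNormalConeP (GphNhat q) (yb + t k • vk k, ystar + t k • vks k)}

/-- The cone `N²_{gph N̂_Γ}((ȳ,ȳ*);(0,v*))`. -/
def N2cone (q : Em m → Em l) (yb ystar vstar : Em m) : Set (Em m × Em m) :=
  {p | ∃ (t : ℕ → ℝ) (vks wks wk : ℕ → Em m),
    (∀ k, 0 < t k) ∧ Tendsto t atTop (𝓝 0) ∧
    Tendsto vks atTop (𝓝 vstar) ∧
    Tendsto (fun k => (wks k, wk k)) atTop (𝓝 p) ∧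
    ∀ k, (wks k, wk k) ∈ regNormalConeP (GphNhat q) (yb, ystar + t k • vks k)}

/-- The union over unit directions in `K̄` appearing in Theorem 7(2). -/
def unionQdir (q : Em m → Em l) (yb ystar vstar : Em m) : Set (Em m × Em m) :=
  {p | ∃ vt : Em m, vt ∈ Kbar q yb ystar ∧ ‖vt‖ = 1 ∧
    ∃ lam mu : Em l, (lam, mu) ∈ Mbar q yb ystar 0 vstar ∧ lam ∈ LamDir q yb ystar vt ∧
    ∃ J ∈ Jbar q yb vt, ∃ Ip I : Set (Fin l),
      IplusLM lam mu ⊆ Ip ∧ Ip ⊆ I ∧ I ⊆ J ∧ p ∈ Qset q yb vt lam Ip I}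

/-- `Λ̄^E(v)`. -/
def LamE (q : Em m → Em l) (yb ystar v : Em m) : Set (Em l) :=
  LamDir q yb ystar v ∩ convexHull ℝ (Set.extremePoints ℝ (Lam q yb ystar))

open Classical in
/-- `Λ̃̄^E(v)`. -/
def LamEt (q : Em m → Em l) (yb ystar v : Em m) : Set (Em l) :=
  if v = 0 then convexHull ℝ (⋃ u ∈ Kbar q yb ystar \ {0}, LamE q yb ystar u)
  else LamE q yb ystar v

/-- The union appearing in Proposition 5 (with `Q₀` and `Λ̃̄^E(ṽ)`). -/
def unionQ0 (q : Em m → Em l) (yb ystar vstar vt : Em m) : Set (Em m × Em m) :=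
  {p | ∃ lam mu : Em l, (lam, mu) ∈ Mbar q yb ystar 0 vstar ∧ lam ∈ LamEt q yb ystar vt ∧
    ∃ J ∈ Jbar q yb vt, ∃ Ip I : Set (Fin l),
      IplusLM lam mu ⊆ Ip ∧ Ip ⊆ I ∧ I ⊆ J ∧ p ∈ Qzero q yb vt lam Ip I}

end Q

section Aubin

/-- The Aubin property of `S` around `(xb, yb)`. -/
def AubinProperty {n m : ℕ} (S : Em n → Set (Em m)) (xb : Em n) (yb : Em m) : Prop :=
  ∃ U ∈ 𝓝 xb, ∃ V ∈ 𝓝 yb, ∃ κ : ℝ, 0 ≤ κ ∧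
    ∀ x1 ∈ U, ∀ x2 ∈ U, ∀ y ∈ S x1 ∩ V, ∃ y' ∈ S x2, ‖y - y'‖ ≤ κ * ‖x1 - x2‖

end Aubin

end

open Asymptotics in
/-- Second order Taylor expansion of a `C²` map between real normed spaces. -/
theorem isLittleO_sub_taylor_two {E F : Type*} [NormedAddCommGroup E] [NormedSpace ℝ E]
    [NormedAddCommGroup F] [NormedSpace ℝ F] {f : E → F} (hf : ContDiff ℝ 2 f) (x : E) :
    (fun y => f y - f x - fderiv ℝ f x (y - x)
      - (1 / 2 : ℝ) • fderiv ℝ (fderiv ℝ f) x (y - x) (y - x)) =o[𝓝 x] fun y => ‖y - x‖ ^ 2 := by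
  have hd : Differentiable ℝ f := hf.differentiable (by norm_num)
  have hd' : Differentiable ℝ (fderiv ℝ f) :=
    (hf.fderiv_right (m := 1) (by norm_num)).differentiable (by norm_num)
  have hsymm : IsSymmSndFDerivAt ℝ f x := hf.contDiffAt.isSymmSndFDerivAt (by simp)
  have hderiv : ∀ y, HasFDerivAt (fun y => f y - fderiv ℝ f x (y - x)
      - (1 / 2 : ℝ) • fderiv ℝ (fderiv ℝ f) x (y - x) (y - x))
      (fderiv ℝ f y - fderiv ℝ f x - fderiv ℝ (fderiv ℝ f) x (y - x)) y := by
    intro y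
    have hid : HasFDerivAt (fun y => y - x) (ContinuousLinearMap.id ℝ E) y :=
      (hasFDerivAt_id y).sub_const x
    have hlin := (fderiv ℝ f x).hasFDerivAt.comp y hid
    have hquad := (((fderiv ℝ (fderiv ℝ f) x).hasFDerivAt.comp y hid).clm_apply hid).const_smul
      (1 / 2 : ℝ)
    refine (((hd y).hasFDerivAt.sub hlin).sub hquad).congr_fderiv ?_
    ext u
    have := hsymm (y - x) u
    simp only [sub_apply, ContinuousLinearMap.comp_apply, smul_apply, add_apply,
      ContinuousLinearMap.flip_apply, ContinuousLinearMap.id_apply, Function.comp_apply]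
    rw [this, ← two_smul ℝ, smul_smul]
    norm_num
  have hsmall : (fun y => fderiv ℝ f y - fderiv ℝ f x - fderiv ℝ (fderiv ℝ f) x (y - x))
      =o[𝓝[univ] x] fun y => ‖y - x‖ ^ 1 := by
    simpa using (hd' x).hasFDerivAt.isLittleO.norm_right
  have := convex_univ.isLittleO_pow_succ (mem_univ x)
    (fun y _ => (hderiv y).hasFDerivWithinAt) hsmall
  simp only [nhdsWithin_univ] at this
  refine this.congr_left fun y => ?_
  simp
  abel

/-- Second order difference quotients along converging directions. -/
theorem tendsto_second_order_quotient {E F ι : Type*} [NormedAddCommGroup E] [NormedSpace ℝ E]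
    [NormedAddCommGroup F] [NormedSpace ℝ F] {f : E → F} (hf : ContDiff ℝ 2 f) (x v : E)
    {L : Filter ι} {t : ι → ℝ} {e : ι → E} (ht : Tendsto t L (𝓝 0)) (ht0 : ∀ᶠ n in L, t n ≠ 0)
    (he : Tendsto e L (𝓝 v)) :
    Tendsto (fun n => (t n ^ 2)⁻¹ • (f (x + t n • e n) - f x - t n • fderiv ℝ f x (e n))) L
      (𝓝 ((1 / 2 : ℝ) • fderiv ℝ (fderiv ℝ f) x v v)) := by
  have hy : Tendsto (fun n => x + t n • e n) L (𝓝 x) := by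
    simpa using (ht.smul he).const_add x
  have hsmall := (isLittleO_sub_taylor_two hf x).comp_tendsto hy
  have hbig : (fun n => ‖t n • e n‖ ^ 2) =O[L] fun n => t n ^ 2 := by
    have : (fun n => t n • e n) =O[L] t := by
      simpa using (Asymptotics.isBigO_refl t L).smul (he.isBigO_one ℝ)
    exact this.norm_left.pow 2
  have hzero :=
    (hsmall.trans_isBigO (by simpa [Function.comp_def] using hbig)).tendsto_inv_smul_nhds_zero
  have hquad : Tendsto (fun n => (1 / 2 : ℝ) • fderiv ℝ (fderiv ℝ f) x (e n) (e n)) L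
      (𝓝 ((1 / 2 : ℝ) • fderiv ℝ (fderiv ℝ f) x v v)) :=
    (((fderiv ℝ (fderiv ℝ f) x).continuous₂.tendsto (v, v)).comp (he.prodMk_nhds he)).const_smul _
  have hsum := hzero.add hquad
  rw [zero_add] at hsum
  refine hsum.congr' ?_
  filter_upwards [ht0] with n hn
  simp only [Function.comp_apply, add_sub_cancel_left, map_smul, smul_apply]
  rw [smul_sub _ _ ((1 / 2 : ℝ) • _), smul_smul, smul_smul, smul_smul]
  have : (t n ^ 2)⁻¹ * (1 / 2) * t n * t n = 1 / 2 := by field_simp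
  rw [this]
  abel

/-- Arcs along which a `C²` map that is `2`-regular in direction `v` takes prescribed small values
and is a submersion. -/
theorem exists_arc_of_twoRegular {X Y : Type*} [NormedAddCommGroup X] [NormedSpace ℝ X]
    [NormedAddCommGroup Y] [NormedSpace ℝ Y] [CompleteSpace Y] {g : X → Y} (hg : ContDiff ℝ 2 g)
    {x v z : X} (hx : g x = 0) (hv : fderiv ℝ g x v = 0)
    (hz : fderiv ℝ g x z + (1 / 2 : ℝ) • fderiv ℝ (fderiv ℝ g) x v v = 0)
    {U W : Y →L[ℝ] X} (hW : ∀ a, fderiv ℝ g x (W a) = 0)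
    (hUW : ∀ a, fderiv ℝ g x (U a) + fderiv ℝ (fderiv ℝ g) x v (W a) = a)
    {c : ℝ → Y} (hc : Tendsto (fun τ => (τ ^ 2)⁻¹ • c τ) (𝓝[>] 0) (𝓝 0)) :
    ∃ a : ℝ → Y, Tendsto a (𝓝[>] 0) (𝓝 0) ∧ ∀ᶠ τ in 𝓝[>] (0 : ℝ),
      g (x + τ • (v + W (a τ) + τ • (z + U (a τ)))) = c τ ∧
      Function.Surjective (fderiv ℝ g (x + τ • (v + W (a τ) + τ • (z + U (a τ))))) := by
  set y : ℝ → Y → X := fun τ a => x + τ • (v + W a + τ • (z + U a)) with hy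
  set G : ℝ → Y → Y := fun τ a => (τ ^ 2)⁻¹ • g (y τ a) with hG
  set D : ℝ → Y → Y →L[ℝ] Y := fun τ a => (fderiv ℝ g (y τ a)).comp U
    + (τ⁻¹ • (fderiv ℝ g (y τ a) - fderiv ℝ g x)).comp W with hD
  have hgd : Differentiable ℝ g := hg.differentiable (by norm_num)
  have hgc : Continuous (fderiv ℝ g) := hg.continuous_fderiv (by norm_num)
  have hgd' : Differentiable ℝ (fderiv ℝ g) :=
    (hg.fderiv_right (m := 1) (by norm_num)).differentiable (by norm_num)
  have hpos : ∀ᶠ τ in 𝓝[>] (0 : ℝ), 0 < τ := eventually_mem_nhdsWithin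
  have hτ : Tendsto (fun τ : ℝ => τ) (𝓝[>] 0) (𝓝 0) := tendsto_id.mono_right nhdsWithin_le_nhds
  have hDcomp : ∀ τ a, 0 < τ → D τ a = τ⁻¹ • (fderiv ℝ g (y τ a)).comp (W + τ • U) := by
    intro τ a h
    ext b
    simp [hD, hW, smul_smul, h.ne', add_comm]
  have hDtendsto : Tendsto (fun p : ℝ × Y => D p.1 p.2) (𝓝[>] 0 ×ˢ 𝓝 0)
      (𝓝 (ContinuousLinearMap.id ℝ Y)) := by
    have h1 : Tendsto (fun p : ℝ × Y => p.1) (𝓝[>] 0 ×ˢ 𝓝 (0 : Y)) (𝓝 0) := hτ.comp tendsto_fst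
    have h2 : Tendsto (fun p : ℝ × Y => p.2) (𝓝[>] (0 : ℝ) ×ˢ 𝓝 (0 : Y)) (𝓝 0) := tendsto_snd
    have he : Tendsto (fun p : ℝ × Y => v + W p.2 + p.1 • (z + U p.2)) (𝓝[>] 0 ×ˢ 𝓝 0)
        (𝓝 v) := by
      have hW0 := (W.continuous.tendsto 0).comp h2
      have hU0 := (U.continuous.tendsto 0).comp h2
      simpa using (hW0.const_add v).add (h1.smul (hU0.const_add z))
    have hd : Tendsto (fun p : ℝ × Y => p.1 • (v + W p.2 + p.1 • (z + U p.2))) (𝓝[>] 0 ×ˢ 𝓝 0)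
        (𝓝 0) := by simpa using h1.smul he
    have hy0 : Tendsto (fun p : ℝ × Y => y p.1 p.2) (𝓝[>] 0 ×ˢ 𝓝 0) (𝓝 x) := by
      simpa only [add_zero] using hd.const_add x
    have hquot : Tendsto (fun p : ℝ × Y => p.1⁻¹ • (fderiv ℝ g (y p.1 p.2) - fderiv ℝ g x))
        (𝓝[>] 0 ×ˢ 𝓝 0) (𝓝 (fderiv ℝ (fderiv ℝ g) x v)) := by
      refine (hgd' x).hasFDerivAt.hasFDerivWithinAt.lim (s := univ) hd (by simp) (he.congr' ?_)
      filter_upwards [tendsto_fst.eventually hpos] with p hp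
      rw [smul_smul, inv_mul_cancel₀ hp.ne', one_smul]
    have hcomp : ∀ T : Y →L[ℝ] X, Continuous fun S : X →L[ℝ] Y => S.comp T := fun T =>
      continuous_id.clm_comp continuous_const
    have hlim := (((hcomp U).tendsto _).comp ((hgc.tendsto x).comp hy0)).add
      (((hcomp W).tendsto _).comp hquot)
    have hid : (fderiv ℝ g x).comp U + (fderiv ℝ (fderiv ℝ g) x v).comp W
        = ContinuousLinearMap.id ℝ Y := ContinuousLinearMap.ext hUW
    rwa [hid] at hlim
  have hGderiv : ∀ τ : ℝ, 0 < τ → ∀ a, HasFDerivAt (G τ) (D τ a) a := by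
    intro τ h a
    have hyd : HasFDerivAt (y τ) (τ • (W + τ • U)) a :=
      (((W.hasFDerivAt.const_add v).add ((U.hasFDerivAt.const_add z).const_smul τ)).const_smul
        τ).const_add x
    refine (((hgd _).hasFDerivAt.comp a hyd).const_smul ((τ ^ 2)⁻¹)).congr_fderiv ?_
    rw [hDcomp τ a h, ContinuousLinearMap.comp_smul, smul_smul]
    congr 1
    field_simp
  have hG0 : Tendsto (fun τ => G τ 0) (𝓝[>] 0) (𝓝 0) := by
    have he : Tendsto (fun τ : ℝ => v + τ • z) (𝓝[>] 0) (𝓝 v) := by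
      simpa using (hτ.smul_const z).const_add v
    have hlim := (tendsto_second_order_quotient hg x v hτ (hpos.mono fun _ h => h.ne') he).const_add
      (fderiv ℝ g x z)
    rw [hz] at hlim
    refine hlim.congr' ?_
    filter_upwards [hpos] with τ h
    simp only [hG, hy, hx, map_add, hv, map_smul, map_zero, add_zero, zero_add, sub_zero, smul_sub,
      smul_smul]
    have : (τ ^ 2)⁻¹ * (τ * τ) = 1 := by field_simp
    rw [this]
    simp
  have hevent : ∀ᶠ p : ℝ × Y in 𝓝[>] 0 ×ˢ 𝓝 0,
      ‖D p.1 p.2 - ContinuousLinearMap.id ℝ Y‖ ≤ 1 / 2 ∧ IsUnit (D p.1 p.2) := by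
    refine Filter.Eventually.and ?_ (hDtendsto.eventually ?_)
    · have := (hDtendsto.sub_const (ContinuousLinearMap.id ℝ Y)).norm
      rw [sub_self, norm_zero] at this
      exact this.eventually_le_const (by norm_num)
    · exact Units.isOpen.mem_nhds isUnit_one
  obtain ⟨P, hP, Q, hQ, hPQ⟩ := Filter.eventually_prod_iff.1 hevent
  obtain ⟨r, hr, hball⟩ := Metric.eventually_nhds_iff_ball.1 hQ
  set ρ : ℝ → ℝ := fun τ => 2 * ‖G τ 0 - (τ ^ 2)⁻¹ • c τ‖ with hρ
  have hρ0 : Tendsto ρ (𝓝[>] 0) (𝓝 0) := by simpa using (hG0.sub hc).norm.const_mul 2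
  have hsol : ∀ᶠ τ in 𝓝[>] (0 : ℝ), ∃ a, ‖a‖ ≤ ρ τ ∧ g (y τ a) = c τ ∧
      Function.Surjective (fderiv ℝ g (y τ a)) := by
    filter_upwards [hpos, hP, hρ0.eventually_lt_const hr] with τ h hPτ hρr
    have happrox : ApproximatesLinearOn (G τ) (ContinuousLinearMap.id ℝ Y) (ball 0 r)
        (1 / 2 : NNReal) := by
      intro a ha b hb
      simpa using (convex_ball (0 : Y) r).norm_image_sub_le_of_norm_hasFDerivWithin_le'
        (fun e _ => (hGderiv τ h e).hasFDerivWithinAt)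
        (fun e he => (hPQ hPτ (hball e he)).1) hb ha
    obtain ⟨a, ha, haG⟩ := happrox.surjOn_closedBall_of_nonlinearRightInverse
      (ε := ρ τ) (b := 0) ⟨id, 1, fun _ => by simp, fun _ => rfl⟩ (by positivity)
      (closedBall_subset_ball hρr) (show (τ ^ 2)⁻¹ • c τ ∈ _ by
        rw [mem_closedBall, dist_comm, dist_eq_norm]
        norm_num [hρ]
        linarith)
    refine ⟨a, by simpa using ha, smul_right_injective Y (inv_ne_zero (pow_ne_zero 2 h.ne')) haG,
      ?_⟩
    have hunit := (hPQ hPτ (hball a (closedBall_subset_ball hρr ha))).2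
    obtain ⟨B, hB⟩ := hunit.exists_right_inv
    intro b
    refine ⟨τ⁻¹ • (W + τ • U) (B b), ?_⟩
    have hBb : D τ a (B b) = b := DFunLike.congr_fun hB b
    rw [hDcomp τ a h] at hBb
    simpa using hBb
  obtain ⟨a, ha⟩ := hsol.choice
  refine ⟨a, squeeze_zero_norm' (ha.mono fun τ h => h.1) hρ0, ha.mono fun τ h => h.2⟩

/-- For finitely many affine functions `t ↦ h i + t * s i`, nonpositive at `0` and not all of
nonpositive slope, some step keeps all of them nonpositive and makes one of positive slope vanish. -/
theorem exists_step_to_boundary {ι : Type*} [Finite ι] {S : Set ι} {h s : ι → ℝ}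
    (hh : ∀ i ∈ S, h i ≤ 0) (hs : ∃ i ∈ S, 0 < s i) :
    ∃ t : ℝ, (∀ i ∈ S, h i + t * s i ≤ 0) ∧ ∃ i ∈ S, 0 < s i ∧ h i + t * s i = 0 := by
  obtain ⟨k, ⟨hkS, hks⟩, hmin⟩ := Set.exists_min_image {i | i ∈ S ∧ 0 < s i}
    (fun i => -h i / s i) (Set.toFinite _) hs
  refine ⟨-h k / s k, fun i hi => ?_, k, hkS, hks, by field_simp; ring⟩
  have hk0 : 0 ≤ -h k / s k := div_nonneg (neg_nonneg.2 (hh k hkS)) hks.le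
  rcases le_or_gt (s i) 0 with hsi | hsi
  · nlinarith [hh i hi, mul_nonneg hk0 (neg_nonneg.2 hsi)]
  · have := hmin i ⟨hi, hsi⟩
    rw [le_div_iff₀ hsi] at this
    linarith

section ActiveSets

variable {m l : ℕ} {q : Em m → Em l} {yb v : Em m}

theorem gradQ_add (y : Em m) (i : Fin l) (u w : Em m) :
    gradQ q y i (u + w) = gradQ q y i u + gradQ q y i w := by
  simp [gradQ]

theorem gradQ_smul (y : Em m) (i : Fin l) (t : ℝ) (u : Em m) :
    gradQ q y i (t • u) = t * gradQ q y i u := by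
  simp [gradQ]

/-- For a maximal index set, the gradients of the remaining constraints that are critical in
direction `v` vanish on the common kernel of the gradients in the index set. -/
theorem MaximalJ.gradQ_eq_zero {J : Set (Fin l)} (hJ : MaximalJ q yb v J) (hv : v ∈ Tlin q yb)
    {i : Fin l} (hi : i ∈ IbarDir q yb v) {d : Em m} (hd : ∀ j ∈ J, gradQ q yb j d = 0) :
    gradQ q yb i d = 0 := by
  by_contra hne
  wlog hpos : 0 < gradQ q yb i d generalizing d
  · have hneg : gradQ q yb i (-d) = -gradQ q yb i d := by simp [gradQ]
    refine this (d := -d) (fun j hj => ?_) (by simpa [hneg] using hne) ?_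
    · simpa [gradQ] using hd j hj
    · rw [hneg]
      exact neg_pos.2 (lt_of_le_of_ne (not_lt.1 hpos) hne)
  obtain ⟨⟨z, hz, rfl⟩, hmax⟩ := hJ
  obtain ⟨t, ht, k, hk, hks, hkt⟩ := exists_step_to_boundary (S := IbarDir q yb v)
    (h := fun i => gradQ q yb i z + hessQ q yb i v v) (s := fun i => gradQ q yb i d)
    (fun i hi => hz i hi.1) ⟨i, hi, hpos⟩
  have hslack : ∀ᶠ σ : ℝ in atTop, ∀ i ∈ actI q yb,
      gradQ q yb i (z + t • d + σ • v) + hessQ q yb i v v ≤ 0 := by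
    rw [eventually_all]
    intro i
    by_cases hi : i ∈ IbarDir q yb v
    · refine Eventually.of_forall fun σ _ => ?_
      have := ht i hi
      rw [gradQ_add, gradQ_add, gradQ_smul, gradQ_smul, hi.2]
      linarith
    · by_cases hact : i ∈ actI q yb
      · have hneg : gradQ q yb i v < 0 := lt_of_le_of_ne (hv i hact) fun h => hi ⟨hact, h⟩
        have hlim : Tendsto (fun σ : ℝ => σ * gradQ q yb i v) atTop atBot :=
          tendsto_id.atTop_mul_const_of_neg hneg
        filter_upwards [hlim.eventually_le_atBot
          (-(gradQ q yb i (z + t • d) + hessQ q yb i v v))] with σ hσ _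
        rw [gradQ_add, gradQ_smul]
        linarith
      · exact Eventually.of_forall fun σ h => absurd h hact
  obtain ⟨σ, hσ⟩ := hslack.exists
  have heq := hmax _ ⟨_, hσ, rfl⟩ fun j hj => ⟨hj.1, by
    rw [gradQ_add, gradQ_add, gradQ_smul, gradQ_smul, hj.1.2, hd j hj]
    linarith [hj.2]⟩
  refine hks.ne' (hd k (heq ▸ ⟨hk, ?_⟩))
  rw [gradQ_add, gradQ_add, gradQ_smul, gradQ_smul, hk.2]
  linarith

/-- Linear independence of the active gradients from surjectivity of the derivative of a larger
family of constraints. -/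
theorem LICQat_of_surjective {y : Em m} (hq : DifferentiableAt ℝ q y) {J : Set (Fin l)}
    (hJ : actI q y ⊆ J) (hs : ∀ α : J → ℝ, ∃ u, ∀ i : J, gradQ q y i u = α i) : LICQat q y := by
  classical
  have hinner : ∀ (i : Fin l) (u : Em m), ⟪gradF q y i, u⟫ = gradQ q y i u := by
    intro i u
    have hcoord := (EuclideanSpace.proj i : Em l →L[ℝ] ℝ).hasFDerivAt.comp y
      hq.hasFDerivAt
    have hfd : fderiv ℝ (fun x => q x i) y = _ := hcoord.fderiv
    rw [gradF, gradient, InnerProductSpace.toDual_symm_apply, hfd]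
    rfl
  refine Fintype.linearIndependent_iff.2 fun a ha i => ?_
  obtain ⟨u, hu⟩ := hs (Pi.single ⟨i, hJ i.2⟩ 1)
  have h0 := congrArg (fun x => ⟪x, u⟫) ha
  simp only [sum_inner, real_inner_smul_left, hinner, inner_zero_left] at h0
  rw [Finset.sum_eq_single i] at h0
  · rw [hu ⟨i, hJ i.2⟩] at h0
    simpa using h0
  · intro j _ hj
    rw [hu ⟨j, hJ j.2⟩, Pi.single_eq_of_ne, mul_zero]
    exact fun h => hj (Subtype.ext (Subtype.mk.inj h))
  · simp

/-- A `2`-regular family admits a linear choice of solutions. -/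
theorem TwoRegular.exists_rightInverse {J : Set (Fin l)} (hJ : TwoRegular q yb v J) :
    ∃ U W : (J → ℝ) →L[ℝ] Em m, (∀ a, ∀ i ∈ J, gradQ q yb i (W a) = 0) ∧
      ∀ a, ∀ i : J, gradQ q yb i (U a) + hessQ q yb i v (W a) = a i := by
  classical
  choose u w huw hw using fun j : J => hJ (Pi.single (j : Fin l) 1)
  refine ⟨(Fintype.linearCombination ℝ u).toContinuousLinearMap,
    (Fintype.linearCombination ℝ w).toContinuousLinearMap, fun a i hi => ?_, fun a i => ?_⟩
  · simp only [gradQ] at hw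
    simp [Fintype.linearCombination_apply, gradQ, hw _ i hi]
  · simp only [gradQ, hessQ] at huw
    simp only [gradQ, hessQ, LinearMap.coe_toContinuousLinearMap', Fintype.linearCombination_apply,
      map_sum, map_smul, WithLp.ofLp_sum, WithLp.ofLp_smul, Finset.sum_apply, Pi.smul_apply,
      smul_eq_mul, ← Finset.sum_add_distrib, ← mul_add, huw _ i i.2]
    rw [Finset.sum_eq_single i (fun j _ hj => by simp [Subtype.coe_ne_coe.2 hj.symm]) (by simp)]
    simp

end ActiveSets

/-- Proposition 4: existence of feasible arcs with prescribed active set under 2-regularity. -/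
theorem statement_7 {m l : ℕ} (q : Em m → Em l) (hq : ContDiff ℝ 2 q)
    (yb : Em m) (hy : yb ∈ Gam q) (v : Em m) (hv : v ∈ Tlin q yb)
    (Jhat : Set (Fin l)) (hJmax : MaximalJ q yb v Jhat)
    (hJreg : TwoRegular q yb v Jhat) :
    ∀ J : Set (Fin l), J ⊆ Jhat →
      ∃ τb > (0:ℝ), ∃ yhat : ℝ → Em m, yhat 0 = yb ∧
        (∀ τ ∈ Set.Icc (0:ℝ) τb, yhat τ ∈ Gam q) ∧
        (∀ τ ∈ Set.Ioo (0:ℝ) τb, actI q (yhat τ) = J ∧ LICQat q (yhat τ)) ∧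
        Tendsto (fun τ : ℝ => τ⁻¹ • (yhat τ - yb)) (𝓝[>] 0) (𝓝 v) := by
  classical
  intro J hJ
  obtain ⟨⟨z, hz, hJz⟩, -⟩ := id hJmax
  obtain ⟨U, W, hW, hUW⟩ := hJreg.exists_rightInverse
  have hker : ∀ a, ∀ i ∈ IbarDir q yb v, gradQ q yb i (W a) = 0 := fun a i hi =>
    hJmax.gradQ_eq_zero hv hi (hW a)
  have hsub : ∀ i ∈ Jhat, i ∈ Jset q yb v z := fun i hi => hJz ▸ hi
  have hqd : Differentiable ℝ q := hq.differentiable (by norm_num)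
  have hqd' : Differentiable ℝ (fderiv ℝ q) :=
    (hq.fderiv_right (m := 1) (by norm_num)).differentiable (by norm_num)
  set P : Em l →L[ℝ] (Jhat → ℝ) := ContinuousLinearMap.pi fun i =>
    (EuclideanSpace.proj (i : Fin l) : Em l →L[ℝ] ℝ) with hP
  set g : Em m → Jhat → ℝ := fun y => P (q y) with hg
  have hgC : ContDiff ℝ 2 g := P.contDiff.comp hq
  have hg1 : fderiv ℝ g = fun y => P.comp (fderiv ℝ q y) :=
    funext fun y => (P.hasFDerivAt.comp y (hqd y).hasFDerivAt).fderiv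
  have hg2 : ∀ u w, fderiv ℝ (fderiv ℝ g) yb u w = P (fderiv ℝ (fderiv ℝ q) yb u w) := by
    intro u w
    have hcomp : HasFDerivAt (fun y => P.comp (fderiv ℝ q y)) _ yb :=
      (ContinuousLinearMap.compL ℝ (Em m) (Em l) (Jhat → ℝ) P).hasFDerivAt.comp yb
        (hqd' yb).hasFDerivAt
    rw [hg1, hcomp.fderiv]
    rfl
  have hgrad : ∀ y u (i : Jhat), fderiv ℝ g y u i = gradQ q y i u := fun y u i => by
    rw [hg1]; rfl
  have hhess : ∀ u w (i : Jhat), fderiv ℝ (fderiv ℝ g) yb u w i = hessQ q yb i u w :=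
    fun u w i => by rw [hg2]; rfl
  have hpos : ∀ᶠ τ in 𝓝[>] (0 : ℝ), 0 < τ := eventually_mem_nhdsWithin
  have hτ : Tendsto (fun τ : ℝ => τ) (𝓝[>] 0) (𝓝 0) := tendsto_id.mono_right nhdsWithin_le_nhds
  obtain ⟨a, ha, hev⟩ := exists_arc_of_twoRegular hgC (x := yb) (v := v) (z := (1 / 2 : ℝ) • z)
    (U := U) (W := W) (c := fun τ i => if (i : Fin l) ∈ J then 0 else -τ ^ 3)
    (funext fun i => (hsub i i.2).1.1)
    (funext fun i => by rw [hgrad]; exact (hsub i i.2).1.2)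
    (funext fun i => by
      have := (hsub i i.2).2
      simp only [Pi.add_apply, Pi.smul_apply, hgrad, hhess, gradQ_smul, Pi.zero_apply,
        smul_eq_mul]
      linarith)
    (fun b => funext fun i => by rw [hgrad]; exact hW b i i.2)
    (fun b => funext fun i => by rw [Pi.add_apply, hgrad, hhess]; exact hUW b i)
    (by
      refine tendsto_pi_nhds.2 fun i => ?_
      by_cases hi : (i : Fin l) ∈ J
      · simp [hi]
      · have hlim : Tendsto (fun τ : ℝ => -τ) (𝓝[>] 0) (𝓝 0) := by simpa using hτ.neg
        refine hlim.congr' ?_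
        filter_upwards [hpos] with τ h
        simp only [Pi.smul_apply, hi, if_false, smul_eq_mul]
        field_simp)
  set e : ℝ → Em m := fun τ => v + W (a τ) + τ • ((1 / 2 : ℝ) • z + U (a τ)) with he_def
  have hWa : Tendsto (fun τ => W (a τ)) (𝓝[>] 0) (𝓝 0) := by
    simpa [Function.comp_def] using (W.continuous.tendsto 0).comp ha
  have hUa : Tendsto (fun τ => U (a τ)) (𝓝[>] 0) (𝓝 0) := by
    simpa [Function.comp_def] using (U.continuous.tendsto 0).comp ha
  have he : Tendsto e (𝓝[>] 0) (𝓝 v) := by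
    have := (hWa.const_add v).add (hτ.smul (hUa.const_add ((1 / 2 : ℝ) • z)))
    simpa only [add_zero, zero_smul] using this
  have hd : Tendsto (fun τ => τ • e τ) (𝓝[>] 0) (𝓝 0) := by
    simpa only [zero_smul] using hτ.smul he
  have hquot : Tendsto (fun τ => τ⁻¹ • (τ • e τ)) (𝓝[>] 0) (𝓝 v) := by
    refine he.congr' ?_
    filter_upwards [hpos] with τ h
    rw [smul_smul, inv_mul_cancel₀ h.ne', one_smul]
  have hcoord : ∀ i : Fin l, Continuous fun x : Em l => x i := fun i =>
    (EuclideanSpace.proj i : Em l →L[ℝ] ℝ).continuous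
  have hneg : ∀ i, i ∉ Jhat → ∀ᶠ τ in 𝓝[>] (0 : ℝ), q (yb + τ • e τ) i < 0 := by
    intro i hi
    by_cases hact : q yb i = 0
    · by_cases hgv : gradQ q yb i v = 0
      · have hlt : gradQ q yb i z + hessQ q yb i v v < 0 :=
          lt_of_le_of_ne (hz i hact) fun h => hi (hJz ▸ ⟨⟨hact, hgv⟩, h⟩)
        have hsnd := ((hcoord i).tendsto _).comp (tendsto_second_order_quotient hq yb v hτ
          (hpos.mono fun _ h => h.ne') he)
        have hfst : Tendsto (fun τ => gradQ q yb i ((1 / 2 : ℝ) • z + U (a τ))) (𝓝[>] 0)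
            (𝓝 (gradQ q yb i ((1 / 2 : ℝ) • z + 0))) :=
          (((hcoord i).comp (fderiv ℝ q yb).continuous).tendsto _).comp (hUa.const_add _)
        have hsum := hsnd.add hfst
        have hlim : ((1 / 2 : ℝ) • fderiv ℝ (fderiv ℝ q) yb v v) i
            + gradQ q yb i ((1 / 2 : ℝ) • z + 0) < 0 := by
          rw [add_zero, gradQ_smul]
          change 1 / 2 * hessQ q yb i v v + _ < 0
          linarith
        filter_upwards [hsum.eventually_lt_const hlim, hpos] with τ hlt' h
        have hlin : fderiv ℝ q yb (e τ) i = τ * gradQ q yb i ((1 / 2 : ℝ) • z + U (a τ)) := by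
          change gradQ q yb i (e τ) = _
          rw [he_def, gradQ_add, gradQ_add, gradQ_smul, hgv, hker _ i ⟨hact, hgv⟩]
          ring
        simp only [Function.comp_apply, PiLp.smul_apply, PiLp.sub_apply, smul_eq_mul, hact,
          hlin] at hlt'
        have hcalc : (τ ^ 2)⁻¹ * (q (yb + τ • e τ) i - 0
            - τ * (τ * gradQ q yb i ((1 / 2 : ℝ) • z + U (a τ))))
            + gradQ q yb i ((1 / 2 : ℝ) • z + U (a τ)) = (τ ^ 2)⁻¹ * q (yb + τ • e τ) i := by
          field_simp
          ring
        rw [hcalc] at hlt'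
        exact neg_of_mul_neg_right hlt' (by positivity)
      · have hlt : gradQ q yb i v < 0 := lt_of_le_of_ne (hv i hact) hgv
        have hlim := ((hcoord i).tendsto _).comp
          ((hqd yb).hasFDerivAt.hasFDerivWithinAt.lim (s := univ) hd (by simp) hquot)
        filter_upwards [hlim.eventually_lt_const hlt, hpos] with τ hlt' h
        simp only [Function.comp_apply, PiLp.smul_apply, PiLp.sub_apply, smul_eq_mul, hact,
          sub_zero] at hlt'
        exact neg_of_mul_neg_right hlt' (by positivity)
    · have hlt : q yb i < 0 := lt_of_le_of_ne (hy i) hact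
      have hy0 : Tendsto (fun τ => yb + τ • e τ) (𝓝[>] 0) (𝓝 yb) := by
        simpa only [add_zero] using hd.const_add yb
      exact ((((hcoord i).comp hqd.continuous).tendsto yb).comp hy0).eventually_lt_const hlt
  have hall : ∀ᶠ τ in 𝓝[>] (0 : ℝ), yb + τ • e τ ∈ Gam q ∧ actI q (yb + τ • e τ) = J ∧
      LICQat q (yb + τ • e τ) := by
    have hneg' : ∀ᶠ τ in 𝓝[>] (0 : ℝ), ∀ i, i ∉ Jhat → q (yb + τ • e τ) i < 0 :=
      eventually_all.2 fun i => by
        by_cases hi : i ∈ Jhat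
        · exact Eventually.of_forall fun _ h => absurd hi h
        · exact (hneg i hi).mono fun _ h _ => h
    filter_upwards [hneg', hev, hpos] with τ hout hin h
    have hval : ∀ i (hi : i ∈ Jhat), q (yb + τ • e τ) i = if i ∈ J then 0 else -τ ^ 3 :=
      fun i hi => congrFun hin.1 ⟨i, hi⟩
    have hzero : ∀ i ∈ J, q (yb + τ • e τ) i = 0 := fun i hi => by
      rw [hval i (hJ hi), if_pos hi]
    have hlt : ∀ i, i ∉ J → q (yb + τ • e τ) i < 0 := fun i hi => by
      by_cases hiJ : i ∈ Jhat
      · rw [hval i hiJ, if_neg hi]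
        exact neg_neg_of_pos (by positivity)
      · exact hout i hiJ
    have hactJ : actI q (yb + τ • e τ) = J := Set.ext fun i =>
      ⟨fun hi => by_contra fun hn => (hlt i hn).ne hi, hzero i⟩
    refine ⟨fun i => ?_, hactJ, LICQat_of_surjective (hqd _) (hactJ.subset.trans hJ) fun α => ?_⟩
    · by_cases hi : i ∈ J
      · exact (hzero i hi).le
      · exact (hlt i hi).le
    · obtain ⟨u, hu⟩ := hin.2 α
      exact ⟨u, fun i => by rw [← hgrad, ← hu]⟩
  obtain ⟨τ₁, hτ₁, hsubset⟩ := mem_nhdsGT_iff_exists_Ioo_subset.1 hall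
  have hτ₁' : (0 : ℝ) < τ₁ := hτ₁
  refine ⟨τ₁ / 2, half_pos hτ₁', fun τ => yb + τ • e τ, by simp, fun τ hτI => ?_,
    fun τ hτI => (hsubset ⟨hτI.1, by linarith [hτI.2]⟩).2, by simpa using hquot⟩
  rcases hτI.1.eq_or_lt with rfl | h
  · simpa using hy
  · exact (hsubset ⟨h, by linarith [hτI.2]⟩).1
end

section
/- Let q : ℝ^m → ℝ^l be twice continuously differentiable, ȳ ∈ ℝ^m, v ∈ ℝ^m, and let I⁺ ⊂ I be index sets contained in {1,…,l}. Then the polar cone of K̄_{I⁺,I}(v) satisfies (K̄_{I⁺,I}(v))° = {∇q(ȳ)ᵀμ + ∇²(νᵀq)(ȳ)v : μ, ν ∈ P_{I⁺,I}, ∇q(ȳ)ᵀν = 0}. -/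
open Set Filter Topology Metric RealInnerProductSpace

/-- The Farkas lemma for a finite system of linear inequalities `f i x ≤ 0` (`i ∈ s`), those with
`i ∈ T` being equations. -/
theorem exists_multipliers_of_forall_nonpos {ι : Type*} (s : Finset ι) (T : Set ι)
    {E : Type*} [AddCommGroup E] [Module ℝ E] (f : ι → E →ₗ[ℝ] ℝ) (g : E →ₗ[ℝ] ℝ)
    (h : ∀ x, (∀ i ∈ s, f i x ≤ 0 ∧ (i ∈ T → f i x = 0)) → g x ≤ 0) :
    ∃ c : ι → ℝ, (∀ i ∉ T, 0 ≤ c i) ∧ (∀ i ∉ s, c i = 0) ∧ ∀ x, g x = ∑ i ∈ s, c i * f i x := by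
  classical
  induction s using Finset.induction_on generalizing f g with
  | empty =>
    refine ⟨0, by simp, by simp, fun x => ?_⟩
    have h1 := h x (by simp)
    have h2 := h (-x) (by simp)
    rw [map_neg] at h2
    simp only [Finset.sum_empty]
    linarith
  | insert a s ha ih =>
    by_cases hs : ∀ x, (∀ i ∈ s, f i x ≤ 0 ∧ (i ∈ T → f i x = 0)) → g x ≤ 0
    · obtain ⟨c, hc, hc0, hg⟩ := ih f g hs
      refine ⟨c, hc, fun i hi => hc0 i fun his => hi (Finset.mem_insert_of_mem his), fun x => ?_⟩
      rw [Finset.sum_insert ha, hc0 a ha, hg x]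
      ring
    · push Not at hs
      obtain ⟨x₀, hx₀, hgx₀⟩ := hs
      have hviol : ¬ (f a x₀ ≤ 0 ∧ (a ∈ T → f a x₀ = 0)) := fun hax =>
        absurd (h x₀ (Finset.forall_mem_insert _ _ _ |>.2 ⟨hax, hx₀⟩)) (not_le.2 hgx₀)
      have hne : f a x₀ ≠ 0 := fun h0 => hviol ⟨h0.le, fun _ => h0⟩
      -- the projection onto the kernel of `f a` along `x₀`
      let π : E →ₗ[ℝ] E := LinearMap.id - ((f a x₀)⁻¹ • f a).smulRight x₀
      have hπ : ∀ (φ : E →ₗ[ℝ] ℝ) y, φ (π y) = φ y - (f a x₀)⁻¹ * f a y * φ x₀ := fun φ y => by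
        simp [π]
      have haπ : ∀ y, f a (π y) = 0 := fun y => by
        rw [hπ]; field_simp; ring
      obtain ⟨c, hc, hc0, hg⟩ := ih (fun i => f i ∘ₗ π) (g ∘ₗ π) fun y hy =>
        h (π y) (Finset.forall_mem_insert _ _ _ |>.2 ⟨⟨(haπ y).le, fun _ => haπ y⟩, hy⟩)
      refine ⟨fun i => if i = a then (f a x₀)⁻¹ * (g x₀ - ∑ j ∈ s, c j * f j x₀) else c i,
        fun i hi => ?_, fun i hi => ?_, fun x => ?_⟩
      · dsimp only
        split_ifs with hia
        · subst hia
          have hpos : 0 < f i x₀ := by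
            by_contra hle
            exact hviol ⟨not_lt.1 hle, fun hT => absurd hT hi⟩
          have hsum : ∑ j ∈ s, c j * f j x₀ ≤ 0 := Finset.sum_nonpos fun j hj => by
            by_cases hjT : j ∈ T
            · rw [(hx₀ j hj).2 hjT, mul_zero]
            · exact mul_nonpos_of_nonneg_of_nonpos (hc j hjT) (hx₀ j hj).1
          exact mul_nonneg (inv_nonneg.2 hpos.le) (by linarith)
        · exact hc i hi
      · rw [Finset.mem_insert, not_or] at hi
        simp only [if_neg hi.1, hc0 i hi.2]
      · have hgx := hg x
        simp only [LinearMap.comp_apply, hπ, mul_sub, Finset.sum_sub_distrib] at hgx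
        have hpull : ∑ i ∈ s, c i * ((f a x₀)⁻¹ * f a x * f i x₀) =
            (f a x₀)⁻¹ * f a x * ∑ i ∈ s, c i * f i x₀ := by
          rw [Finset.mul_sum]
          exact Finset.sum_congr rfl fun i _ => by ring
        have hrest : ∑ i ∈ s, (if i = a then (f a x₀)⁻¹ * (g x₀ - ∑ j ∈ s, c j * f j x₀)
            else c i) * f i x = ∑ i ∈ s, c i * f i x :=
          Finset.sum_congr rfl fun i hi => by rw [if_neg (ne_of_mem_of_not_mem hi ha)]
        rw [Finset.sum_insert ha]
        beta_reduce
        rw [if_pos rfl, hrest]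
        rw [hpull] at hgx
        linear_combination hgx

theorem inner_gradT {m l : ℕ} (q : Em m → Em l) (y : Em m) (lam : Em l) (w : Em m) :
    ⟪gradT q y lam, w⟫ = ∑ i, lam i * gradQ q y i w := by
  simp [gradT, gradQ, ContinuousLinearMap.adjoint_inner_left, PiLp.inner_apply, mul_comm]

theorem inner_hessT {m l : ℕ} (q : Em m → Em l) (y : Em m) (lam : Em l) (v w : Em m) :
    ⟪hessT q y lam v, w⟫ = ∑ i, lam i * hessQ q y i v w := by
  simp [hessT, hessQ, ContinuousLinearMap.adjoint_inner_left, PiLp.inner_apply, mul_comm]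

theorem sum_mul_nonpos_of_mem_Pset {l : ℕ} {Ip I : Set (Fin l)} {mu : Em l} (hmu : mu ∈ Pset Ip I)
    {a : Fin l → ℝ} (h0 : ∀ i ∈ Ip, a i = 0) (h1 : ∀ i ∈ I \ Ip, a i ≤ 0) :
    ∑ i, mu i * a i ≤ 0 := by
  refine Finset.sum_nonpos fun i _ => ?_
  by_cases hp : i ∈ Ip
  · rw [h0 i hp, mul_zero]
  · by_cases hi : i ∈ I
    · exact mul_nonpos_of_nonneg_of_nonpos (hmu.2 i ⟨hi, hp⟩) (h1 i ⟨hi, hp⟩)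
    · rw [hmu.1 i hi, zero_mul]

/-- Lemma 1: the polar cone of `K̄_{I⁺,I}(v)`. -/
theorem statement_8 {m l : ℕ} (q : Em m → Em l) (hq : ContDiff ℝ 2 q)
    (yb v : Em m) (Ip I : Set (Fin l)) (hII : Ip ⊆ I) :
    polarCone (KconeDir q yb Ip I v) =
      {x | ∃ mu nu : Em l, mu ∈ Pset Ip I ∧ nu ∈ Pset Ip I ∧ gradT q yb nu = 0 ∧
        x = gradT q yb mu + hessT q yb nu v} := by
  classical
  ext x
  constructor
  · intro hx
    let A : Fin l → Em m →ₗ[ℝ] ℝ := fun i =>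
      (EuclideanSpace.proj i ∘L fderiv ℝ q yb : Em m →L[ℝ] ℝ)
    let B : Fin l → Em m →ₗ[ℝ] ℝ := fun i =>
      (EuclideanSpace.proj i ∘L fderiv ℝ (fderiv ℝ q) yb v : Em m →L[ℝ] ℝ)
    have hA : ∀ i w, A i w = gradQ q yb i w := fun i w => rfl
    have hB : ∀ i w, B i w = hessQ q yb i v w := fun i w => rfl
    obtain ⟨c, hc, hc0, hcx⟩ := exists_multipliers_of_forall_nonpos
      (Finset.univ.filter fun j : Fin l ⊕ Fin l => Sum.elim id id j ∈ I)
      {j | Sum.elim id id j ∈ Ip}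
      (Sum.elim (fun i => A i ∘ₗ LinearMap.fst ℝ (Em m) (Em m))
        fun i => A i ∘ₗ LinearMap.snd ℝ (Em m) (Em m) + B i ∘ₗ LinearMap.fst ℝ (Em m) (Em m))
      ((innerSL ℝ x : Em m →ₗ[ℝ] ℝ) ∘ₗ LinearMap.fst ℝ (Em m) (Em m)) (by
        rintro ⟨w, z⟩ hwz
        have hl := fun i (hi : i ∈ I) => hwz (Sum.inl i) (by simpa using hi)
        have hr := fun i (hi : i ∈ I) => hwz (Sum.inr i) (by simpa using hi)
        exact hx w ⟨⟨fun i hi => (hl i (hII hi)).2 hi, fun i hi => (hl i hi.1).1⟩,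
          z, fun i hi => (hr i (hII hi)).2 hi, fun i hi => (hr i hi.1).1⟩)
    have hcsum : ∀ w z, ⟪x, w⟫ = ∑ i, c (Sum.inl i) * gradQ q yb i w +
        ∑ i, c (Sum.inr i) * (gradQ q yb i z + hessQ q yb i v w) := fun w z => by
      have h := hcx (w, z)
      rw [Finset.sum_subset (Finset.subset_univ _) fun j _ hj => by rw [hc0 j hj, zero_mul],
        Fintype.sum_sum_type] at h
      exact h
    have hP : ∀ k : Fin l → Fin l ⊕ Fin l, (∀ i, Sum.elim id id (k i) = i) →
        WithLp.toLp 2 (fun i => c (k i)) ∈ Pset Ip I := fun k hk =>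
      ⟨fun i hi => hc0 _ (by simpa [hk] using hi), fun i hi => hc _ (by simpa [hk] using hi.2)⟩
    refine ⟨WithLp.toLp 2 fun i => c (Sum.inl i), WithLp.toLp 2 fun i => c (Sum.inr i),
      hP Sum.inl fun _ => rfl, hP Sum.inr fun _ => rfl, ?_, ?_⟩
    · refine ext_inner_right ℝ fun z => ?_
      have h := hcsum 0 z
      rw [inner_gradT, inner_zero_left]
      simpa [gradQ, hessQ] using h.symm
    · refine ext_inner_right ℝ fun w => ?_
      rw [inner_add_left, inner_gradT, inner_hessT, hcsum w 0]
      simp [gradQ]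
  · rintro ⟨mu, nu, hmu, hnu, hgrad, rfl⟩ w ⟨hw, z, hz0, hz1⟩
    have h1 := sum_mul_nonpos_of_mem_Pset hmu hw.1 hw.2
    have h2 := sum_mul_nonpos_of_mem_Pset hnu hz0 hz1
    have h3 := inner_gradT q yb nu z
    rw [hgrad, inner_zero_left] at h3
    simp only [mul_add, Finset.sum_add_distrib] at h2
    rw [inner_add_left, inner_gradT, inner_hessT]
    linarith
end

section
/- Let q : ℝ^m → ℝ^l be twice continuously differentiable, Γ := {y : q_i(y) ≤ 0, i=1,…,l}, ȳ ∈ Γ, ȳ* ∈ N̂_Γ(ȳ). Let v* ≠ 0 with (0,v*) ∈ T_{gph N̂_Γ}(ȳ,ȳ*) and assume that M_q is metrically subregular at (ȳ,0). If K̄ = {0}, then N²_{gph N̂_Γ}((ȳ,ȳ*);(0,v*)) ⊂ ℝ^m × {0}. -/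
open Set Filter Topology Metric RealInnerProductSpace

section TangentCone

variable {H : Type*} [NormedAddCommGroup H] [NormedSpace ℝ H]

theorem mem_tanCone_iff {Ω : Set H} {z u : H} :
    u ∈ tanCone Ω z ↔
      ∀ ε > (0 : ℝ), ∃ t : ℝ, 0 < t ∧ t < ε ∧ ∃ w : H, dist w u < ε ∧ z + t • w ∈ Ω := by
  constructor
  · rintro ⟨t, w, ht, ht0, hw, hmem⟩ ε hε
    have h1 : ∀ᶠ k in atTop, t k < ε := ht0.eventually_lt_const hε
    have h2 : ∀ᶠ k in atTop, dist (w k) u < ε := hw.eventually (ball_mem_nhds u hε)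
    obtain ⟨k, hk1, hk2⟩ := (h1.and h2).exists
    exact ⟨t k, ht k, hk1, w k, hk2, hmem k⟩
  · intro h
    choose t ht htε w hw hmem using fun k : ℕ => h (1 / ((k : ℝ) + 1)) (by positivity)
    have hlim : Tendsto (fun k : ℕ => 1 / ((k : ℝ) + 1)) atTop (𝓝 0) :=
      tendsto_one_div_add_atTop_nhds_zero_nat
    refine ⟨t, w, ht, ?_, ?_, hmem⟩
    · exact squeeze_zero (fun k => (ht k).le) (fun k => (htε k).le) hlim
    · exact tendsto_iff_dist_tendsto_zero.2
        (squeeze_zero (fun k => dist_nonneg) (fun k => (hw k).le) hlim)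

theorem isClosed_tanCone (Ω : Set H) (z : H) : IsClosed (tanCone Ω z) := by
  refine isClosed_of_closure_subset fun u hu => mem_tanCone_iff.2 fun ε hε => ?_
  obtain ⟨v, hv, huv⟩ := Metric.mem_closure_iff.1 hu (ε / 2) (half_pos hε)
  obtain ⟨t, ht, htε, w, hw, hmem⟩ := mem_tanCone_iff.1 hv (ε / 2) (half_pos hε)
  refine ⟨t, ht, by linarith, w, ?_, hmem⟩
  have := dist_triangle w v u
  rw [dist_comm v u] at this
  linarith

theorem smul_mem_tanCone {Ω : Set H} {z u : H} (hu : u ∈ tanCone Ω z) {c : ℝ} (hc : 0 < c) :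
    c • u ∈ tanCone Ω z := by
  obtain ⟨t, w, ht, ht0, hw, hmem⟩ := hu
  refine ⟨fun k => t k / c, fun k => c • w k, fun k => div_pos (ht k) hc, ?_,
    hw.const_smul c, fun k => ?_⟩
  · simpa using ht0.div_const c
  · simpa only [smul_smul, div_mul_cancel₀ _ hc.ne'] using hmem k

theorem mem_tanCone_of_forall_smul {Ω : Set H} {z u : H} {s : ℝ} (hs : 0 < s)
    (h : ∀ t, 0 < t → t < s → z + t • u ∈ Ω) : u ∈ tanCone Ω z := by
  refine mem_tanCone_iff.2 fun ε hε => ?_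
  obtain ⟨t, ht, hts⟩ := exists_between (lt_min hs hε)
  exact ⟨t, ht, hts.trans_le (min_le_right _ _), u, by simpa using hε,
    h t ht (hts.trans_le (min_le_left _ _))⟩

end TangentCone

theorem regNormalCone_mem_nhds_of_critical {H : Type*} [NormedAddCommGroup H]
    [InnerProductSpace ℝ H] [FiniteDimensional ℝ H] {Ω : Set H} {z x : H}
    (hx : x ∈ regNormalCone Ω z) (hK : ∀ v ∈ tanCone Ω z, ⟪x, v⟫ = 0 → v = 0) :
    regNormalCone Ω z ∈ 𝓝 x := by
  obtain ⟨c, hc, hbound⟩ : ∃ c > (0 : ℝ), ∀ v ∈ tanCone Ω z, ‖v‖ = 1 → ⟪x, v⟫ ≤ -c := by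
    have hcomp : IsCompact (tanCone Ω z ∩ sphere 0 1) :=
      (isCompact_sphere 0 1).inter_left (isClosed_tanCone Ω z)
    rcases (tanCone Ω z ∩ sphere (0 : H) 1).eq_empty_or_nonempty with he | hne
    · refine ⟨1, one_pos, fun v hv hv1 => ?_⟩
      have : v ∈ tanCone Ω z ∩ sphere (0 : H) 1 := ⟨hv, by simpa using hv1⟩
      simp [he] at this
    · obtain ⟨u, ⟨hu, hu1⟩, hmax⟩ := hcomp.exists_isMaxOn hne
        (f := fun v => ⟪x, v⟫) (by fun_prop)
      refine ⟨-⟪x, u⟫, ?_, fun v hv hv1 => ?_⟩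
      · have hle : ⟪x, u⟫ ≤ 0 := hx u hu
        have hne0 : ⟪x, u⟫ ≠ 0 := fun h0 => by
          have := hK u hu h0
          simp [this] at hu1
        have := lt_of_le_of_ne hle hne0
        linarith
      · rw [neg_neg]
        exact hmax ⟨hv, by simpa using hv1⟩
  refine Filter.mem_of_superset (ball_mem_nhds x hc) fun y hy v hv => ?_
  rcases eq_or_ne v 0 with rfl | hv0
  · simp
  have hpos : 0 < ‖v‖ := norm_pos_iff.2 hv0
  have hb := hbound _ (smul_mem_tanCone hv (inv_pos.2 hpos))
    (by rw [norm_smul, norm_inv, norm_norm, inv_mul_cancel₀ hpos.ne'])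
  rw [inner_smul_right, inv_mul_le_iff₀ hpos] at hb
  have h1 : ⟪y - x, v⟫ ≤ ‖y - x‖ * ‖v‖ := real_inner_le_norm _ _
  have h2 : ‖y - x‖ < c := by simpa [dist_eq_norm] using hy
  rw [inner_sub_left] at h1
  nlinarith

theorem snd_eq_zero_of_mem_regNormalConeP {E F : Type*} [NormedAddCommGroup E]
    [InnerProductSpace ℝ E] [NormedAddCommGroup F] [InnerProductSpace ℝ F]
    {Ω : Set (E × F)} {a : E} {b : F} (h : ∀ᶠ y in 𝓝 b, (a, y) ∈ Ω) {p : E × F}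
    (hp : p ∈ regNormalConeP Ω (a, b)) : p.2 = 0 := by
  have hlim : Tendsto (fun t : ℝ => b + t • p.2) (𝓝 0) (𝓝 b) := by
    have : Continuous fun t : ℝ => b + t • p.2 := by fun_prop
    simpa using this.tendsto 0
  obtain ⟨s, hs, hball⟩ := Metric.eventually_nhds_iff.1 (hlim.eventually h)
  have hmem : ((0 : E), p.2) ∈ tanCone Ω (a, b) :=
    mem_tanCone_of_forall_smul hs fun t ht hts => by
      simpa using hball (y := t) (by simpa [abs_of_pos ht] using hts)
  have := hp _ hmem
  simp only [inner_zero_right, zero_add] at this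
  exact real_inner_self_nonpos.1 this

/-- Proposition 5, case `K̄ = {0}`. -/
theorem statement_15 {m l : ℕ} (q : Em m → Em l) (hq : ContDiff ℝ 2 q)
    (yb ystar : Em m) (hy : yb ∈ Gam q) (hys : ystar ∈ regNormalCone (Gam q) yb)
    (hsub : MetricallySubregularAt (Mq q) yb (0 : Em l))
    (vstar : Em m) (hvs : vstar ≠ 0)
    (htan : ((0 : Em m), vstar) ∈ tanCone (GphNhat q) (yb, ystar))
    (hK : Kbar q yb ystar = {0}) :
    N2cone q yb ystar vstar ⊆ Set.univ ×ˢ ({0} : Set (Em m)) := by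
  rintro ⟨ws, w⟩ ⟨t, vks, wks, wk, -, ht0, hv, hlim, hmem⟩
  refine ⟨mem_univ _, ?_⟩
  have hnhds : regNormalCone (Gam q) yb ∈ 𝓝 ystar :=
    regNormalCone_mem_nhds_of_critical hys fun v hvT hv0 => by
      have : v ∈ Kbar q yb ystar := ⟨hvT, hv0⟩
      simpa [hK] using this
  have hpt : Tendsto (fun k => ystar + t k • vks k) atTop (𝓝 ystar) := by
    simpa using (ht0.smul hv).const_add ystar
  have hzero : ∀ᶠ k in atTop, wk k = 0 := by
    filter_upwards [hpt.eventually (eventually_mem_nhds_iff.2 hnhds)] with k hk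
    refine snd_eq_zero_of_mem_regNormalConeP ?_ (hmem k)
    filter_upwards [hk] with y hy' using ⟨hy, hy'⟩
  have hw : Tendsto wk atTop (𝓝 w) := (continuous_snd.tendsto _).comp hlim
  exact tendsto_nhds_unique hw (tendsto_const_nhds.congr' (hzero.mono fun k hk => hk.symm))
end
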